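/- Let G be a simple undirected graph with m edges and maximum degree d. Then the maximum matching size k satisfies k ≥ (2/3) * (m / d) (i.e., 2 * m ≤ 3 * k * d). -/

import Mathlib

theorem matching_card_verts_aux {V : Type*} [Fintype V] (G : SimpleGraph V)
    (M : G.Subgraph) (hM : M.IsMatching) :
    M.verts.ncard = 2 * M.edgeSet.ncard := by
  classical
  have h := M.spanningCoe.sum_degrees_eq_twice_card_edges
  have h1 : M.spanningCoe.edgeFinset.card = M.edgeSet.ncard := by
    rw [← Set.ncard_coe_finset, SimpleGraph.coe_edgeFinset, SimpleGraph.Subgraph.edgeSet_spanningCoe]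
  have h2 : ∀ v, M.spanningCoe.degree v = if v ∈ M.verts then 1 else 0 := by
    intro v
    split_ifs with hv
    · obtain ⟨w, hw, hu⟩ := hM hv
      rw [← SimpleGraph.card_neighborFinset_eq_degree, Finset.card_eq_one]
      refine ⟨w, ?_⟩
      ext z
      simp only [SimpleGraph.mem_neighborFinset, SimpleGraph.Subgraph.spanningCoe_adj,
        Finset.mem_singleton]
      exact ⟨fun hz => hu z hz, fun hz => hz ▸ hw⟩
    · rw [← SimpleGraph.card_neighborFinset_eq_degree, Finset.card_eq_zero]
      ext z
      simp only [SimpleGraph.mem_neighborFinset, SimpleGraph.Subgraph.spanningCoe_adj,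
        Finset.notMem_empty, iff_false]
      exact fun hz => hv hz.fst_mem
  rw [h1] at h
  rw [← h, Finset.sum_congr rfl (fun v _ => h2 v), Finset.sum_boole]
  simp only [Nat.cast_id]
  rw [← Set.ncard_coe_finset]
  simp

theorem involution_card_le_aux {V : Type*} [Fintype V] (G : SimpleGraph V) (k : ℕ)
    (hmax : ∀ M' : G.Subgraph, M'.IsMatching → M'.edgeSet.ncard ≤ k)
    (S : Finset V) (p : V → V) (h1 : ∀ v ∈ S, p v ∈ S) (h2 : ∀ v ∈ S, p (p v) = v)
    (h3 : ∀ v ∈ S, G.Adj v (p v)) : S.card ≤ 2 * k := by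
  let M' : G.Subgraph :=
    { verts := S
      Adj := fun a b => a ∈ S ∧ b = p a
      adj_sub := by
        rintro a b ⟨ha, rfl⟩
        exact h3 a ha
      edge_vert := by
        rintro a b ⟨ha, rfl⟩
        exact ha
      symm := ⟨by
        rintro a b ⟨ha, rfl⟩
        exact ⟨h1 a ha, (h2 a ha).symm⟩⟩ }
  have hM' : M'.IsMatching := by
    intro v hv
    exact ⟨p v, ⟨hv, rfl⟩, fun y hy => hy.2⟩
  have h := matching_card_verts_aux G M' hM'
  have h' : M'.verts.ncard = S.card := Set.ncard_coe_finset S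
  have := hmax M' hM'
  omega

/-- If `G` has `m` edges and maximum degree `d`, then the maximum
matching size `k` satisfies `2 * m ≤ 3 * k * d`, i.e. `k ≥ (2/3) * (m / d)`. -/
theorem max_matching_ge_two_thirds_m_div_d {V : Type*} [Fintype V] (G : SimpleGraph V)
    [DecidableRel G.Adj] (M : G.Subgraph) (hM : M.IsMatching)
    (hmax : ∀ M' : G.Subgraph, M'.IsMatching → M'.edgeSet.ncard ≤ M.edgeSet.ncard) :
    2 * G.edgeFinset.card ≤ 3 * M.edgeSet.ncard * G.maxDegree := by
  classical
  have hc := matching_card_verts_aux G M hM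
  generalize M.edgeSet.ncard = k at *
  have hinv := involution_card_le_aux G k hmax
  obtain ⟨S, hS⟩ : ∃ S : Finset V, (S : Set V) = M.verts := ⟨M.verts.toFinset, by simp⟩
  rw [← hS, Set.ncard_coe_finset] at hc
  have hex : ∀ v, ∃ w, v ∈ S → M.Adj v w := by
    intro v
    by_cases hv : v ∈ S
    · obtain ⟨w, hw, -⟩ := hM (v := v) (by rw [← hS]; exact hv)
      exact ⟨w, fun _ => hw⟩
    · exact ⟨v, fun h => absurd h hv⟩
  choose p hp using hex
  have h1 : ∀ v ∈ S, p v ∈ S := fun v hv => by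
    have := (hp v hv).snd_mem
    rwa [← hS] at this
  have h2 : ∀ v ∈ S, p (p v) = v := fun v hv =>
    hM.eq_of_adj_left (hp (p v) (h1 v hv)) (hp v hv).symm
  have h3 : ∀ v ∈ S, G.Adj v (p v) := fun v hv => (hp v hv).adj_sub
  clear hp hS
  -- unmatched vertices are independent
  have hind : ∀ x y, x ∉ S → y ∉ S → ¬ G.Adj x y := by
    intro x y hx hy hxy
    have hne := hxy.ne
    have hyx := hxy.symm
    have := hinv (insert x (insert y S)) (fun v => if v = x then y else if v = y then x else p v)
      (by grind) (by grind) (by grind)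
    rw [Finset.card_insert_of_notMem (by grind), Finset.card_insert_of_notMem hy] at this
    omega
  -- no augmenting path of length three
  have haug : ∀ u ∈ S, ∀ x y, x ∉ S → y ∉ S → G.Adj u x → G.Adj (p u) y → x = y := by
    intro u hu x y hx hy hux hvy
    by_contra hne
    have hxu := hux.symm
    have hyv := hvy.symm
    have hpu := (h3 u hu).ne
    have a1 := h1 u hu
    have a2 := h2 u hu
    have := hinv (insert x (insert y S)) (fun v => if v = x then u else if v = u then x else
      if v = y then p u else if v = p u then y else p v)
      (by grind) (by grind) (by grind)
    rw [Finset.card_insert_of_notMem (by grind), Finset.card_insert_of_notMem hy] at this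
    omega
  let f : V → ℕ := fun u => (Sᶜ.filter (fun x => G.Adj u x)).card
  have hfd : ∀ u, f u ≤ G.maxDegree := by
    intro u
    refine le_trans ?_ (G.degree_le_maxDegree u)
    rw [← G.card_neighborFinset_eq_degree]
    apply Finset.card_le_card
    intro x
    simp
  have hfs : ∀ u ∈ S, f u + 1 ≤ G.maxDegree := by
    intro u hu
    refine le_trans ?_ (G.degree_le_maxDegree u)
    rw [← G.card_neighborFinset_eq_degree]
    have a1 := h1 u hu
    have a3 := h3 u hu
    rw [← Finset.card_insert_of_notMem (a := p u) (by simp [a1])]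
    apply Finset.card_le_card
    intro x
    simp only [Finset.mem_insert, Finset.mem_filter, SimpleGraph.mem_neighborFinset]
    grind
  have hpair : ∀ u ∈ S, f u + f (p u) ≤ G.maxDegree := by
    intro u hu
    by_cases h0 : f (p u) = 0
    · have := hfd u
      omega
    · obtain ⟨y, hy⟩ := Finset.card_pos.mp (Nat.pos_of_ne_zero h0)
      have hle : f (p u) ≤ 1 ∨ f u = 0 := by
        by_contra! hcon
        obtain ⟨x, hx⟩ := Finset.card_pos.mp (Nat.pos_of_ne_zero hcon.2)
        simp only [Finset.mem_filter, Finset.mem_compl] at hx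
        obtain ⟨a, ha, b, hb, hab⟩ := Finset.one_lt_card.mp hcon.1
        simp only [Finset.mem_filter, Finset.mem_compl] at ha hb
        exact hab ((haug u hu x a hx.1 ha.1 hx.2 ha.2).symm.trans
          (haug u hu x b hx.1 hb.1 hx.2 hb.2))
      have e1 := hfs u hu
      have e2 := hfs (p u) (h1 u hu)
      omega
  have hsum : ∑ u ∈ S, f (p u) = ∑ u ∈ S, f u :=
    Finset.sum_nbij' p p h1 h1 h2 h2 (fun _ _ => rfl)
  have hS2 : 2 * ∑ u ∈ S, f u ≤ S.card * G.maxDegree := by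
    calc 2 * ∑ u ∈ S, f u = ∑ u ∈ S, (f u + f (p u)) := by
          rw [Finset.sum_add_distrib, hsum]; ring
      _ ≤ ∑ u ∈ S, G.maxDegree := Finset.sum_le_sum hpair
      _ = _ := by simp
  have hout : ∑ v ∈ Sᶜ, G.degree v = ∑ u ∈ S, f u := by
    have : ∀ v ∈ Sᶜ, G.degree v = (S.filter (fun u => G.Adj u v)).card := by
      intro v hv
      rw [← G.card_neighborFinset_eq_degree]
      congr 1
      ext z
      simp only [SimpleGraph.mem_neighborFinset, Finset.mem_filter]
      rw [Finset.mem_compl] at hv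
      constructor
      · intro h
        refine ⟨?_, h.symm⟩
        by_contra hz
        exact hind v z hv hz h
      · exact fun h => h.2.symm
    rw [Finset.sum_congr rfl this]
    exact (Finset.sum_card_bipartiteAbove_eq_sum_card_bipartiteBelow (s := S) (t := Sᶜ) G.Adj).symm
  have hin : ∑ v ∈ S, G.degree v ≤ S.card * G.maxDegree := by
    calc _ ≤ ∑ u ∈ S, G.maxDegree := Finset.sum_le_sum (fun v _ => G.degree_le_maxDegree v)
      _ = _ := by simp
  have htot := G.sum_degrees_eq_twice_card_edges
  rw [← Finset.sum_add_sum_compl S, hout] at htot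
  rw [hc] at hin hS2
  rw [← htot]
  nlinarith
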